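/- arXiv:2106.12611 — 3 statements merged into one kernel-verified Lean document; each statement's English description precedes it below -/
import Mathlib

section
/- For all x ∈ [0, π]: sin(x) − x·cos(x) ≥ (1 − cos x)^{3/2} / 15. -/
/-- **Statement 13**: for all `x ∈ [0, π]`, `sin x − x·cos x ≥ (1 − cos x)^{3/2} / 15`. -/
theorem stmt13 :
    ∀ x ∈ Set.Icc (0:ℝ) Real.pi,
      Real.sin x - x * Real.cos x ≥ (1 - Real.cos x) ^ ((3:ℝ)/2) / 15 := by
  rintro x ⟨h0, h1⟩
  obtain ⟨t, rfl⟩ : ∃ t, x = 2 * t := ⟨x / 2, by ring⟩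
  have ht : 0 ≤ t := by linarith
  have ht2 : t ≤ Real.pi / 2 := by linarith
  have hs : 0 ≤ Real.sin t := Real.sin_nonneg_of_nonneg_of_le_pi ht (by linarith [Real.pi_pos])
  have hst : Real.sin t ≤ t := Real.sin_le ht
  have hc : 0 ≤ Real.cos t := Real.cos_nonneg_of_neg_pi_div_two_le_of_le (by linarith) ht2
  have hsc := Real.sin_sq_add_cos_sq t
  have key : t * Real.cos t ^ 2 ≤ Real.sin t * Real.cos t := by
    rcases hc.eq_or_lt with h | h
    · rw [← h]; simp
    · have hlt : t < Real.pi / 2 := by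
        rcases ht2.eq_or_lt with h' | h'
        · rw [h', Real.cos_pi_div_two] at h; exact absurd h (lt_irrefl _)
        · exact h'
      have h2 := Real.le_tan ht hlt
      rw [Real.tan_eq_sin_div_cos, le_div_iff₀ h] at h2
      nlinarith
  have hcos : Real.cos (2 * t) = 1 - 2 * Real.sin t ^ 2 := by
    rw [Real.cos_two_mul]; linarith
  have hr : (1 - Real.cos (2 * t)) ^ ((3:ℝ)/2) ≤ 8 * Real.sin t ^ 3 := by
    calc (1 - Real.cos (2 * t)) ^ ((3:ℝ)/2) ≤ ((2 * Real.sin t) ^ (2:ℝ)) ^ ((3:ℝ)/2) := by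
          apply Real.rpow_le_rpow
          · linarith [Real.cos_le_one (2 * t)]
          · rw [hcos, Real.rpow_two]; nlinarith [sq_nonneg (Real.sin t)]
          · norm_num
      _ = (2 * Real.sin t) ^ (3:ℝ) := by
          rw [← Real.rpow_mul (by positivity)]; norm_num
      _ = (2 * Real.sin t) ^ (3:ℕ) := by
          rw [← Real.rpow_natCast]; norm_num
      _ = 8 * Real.sin t ^ 3 := by ring
  have h3 : Real.sin t ^ 3 ≤ t * Real.sin t ^ 2 := by
    nlinarith [mul_le_mul_of_nonneg_right hst (sq_nonneg (Real.sin t))]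
  have h4 : 0 ≤ Real.sin t ^ 3 := by positivity
  have h5 : Real.sin (2 * t) - 2 * t * Real.cos (2 * t)
      = 2 * (Real.sin t * Real.cos t) - 2 * (t * Real.cos t ^ 2) + 2 * (t * Real.sin t ^ 2) := by
    rw [Real.sin_two_mul, Real.cos_two_mul']; ring
  rw [h5]
  linarith
end

section
/- Let d ∈ ℕ with d ≥ 40. Then for all k ∈ ℕ, r ≥ 0, t ≥ 0, and M ∈ ℝ^{k×d}: P_{Z ~ Unif(r·S^{d−1})}[ ‖MZ‖ ≥ t ] ≤ 2 · P_{Y ~ N(0, (2r²/d)·I_d)}[ ‖MY‖ ≥ t ]. -/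
open MeasureTheory ProbabilityTheory

noncomputable section

/-- Euclidean norm of a finite real vector. -/
def evNorm {n : ℕ} (v : Fin n → ℝ) : ℝ := Real.sqrt (∑ i, v i ^ 2)

/-- Matrix-vector product. -/
def mulVecFn {a b : ℕ} (M : Fin a → Fin b → ℝ) (v : Fin b → ℝ) : Fin a → ℝ :=
  fun j => ∑ k, M j k * v k

/-- The standard Gaussian measure `N(0, I_d)` on `ℝ^d`. -/
def stdGauss (d : ℕ) : Measure (Fin d → ℝ) :=
  Measure.pi fun _ => gaussianReal 0 1

/-- The uniform distribution on the sphere of radius `r` in `ℝ^d`, realized as the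
pushforward of the standard Gaussian under radial projection onto the sphere. -/
def unifSphere (d : ℕ) (r : ℝ) : Measure (Fin d → ℝ) :=
  Measure.map (fun y => fun i => (r / evNorm y) * y i) (stdGauss d)

lemma pi_scale (d : ℕ) (s : ℝ) (v : NNReal) (hv : (v : ℝ) = s ^ 2) :
    (Measure.pi fun _ : Fin d => gaussianReal 0 v) =
      Measure.map (fun y i => s * y i) (stdGauss d) := by
  have h : gaussianReal 0 v = (gaussianReal 0 1).map (fun x => s * x) := by
    rw [gaussianReal_map_const_mul]
    congr 1
    · simp
    · ext; simp [hv]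
  rw [stdGauss, h]
  have := Measure.pi_map_pi (ι := Fin d) (μ := fun _ => gaussianReal 0 1)
    (f := fun _ x => s * x) (fun i => by fun_prop)
  rw [this]

def dens (x : ℝ) : ENNReal := ENNReal.ofReal ((Real.sqrt 2)⁻¹ * Real.exp (x ^ 2 / 4))

lemma dens_meas : Measurable dens := by unfold dens; fun_prop

lemma gauss_two : gaussianReal 0 2 = (gaussianReal 0 1).withDensity dens := by
  rw [gaussianReal_of_var_ne_zero _ (by norm_num), gaussianReal_of_var_ne_zero _ (by norm_num),
    ← withDensity_mul _ (measurable_gaussianPDF _ _) dens_meas]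
  congr 1
  ext x
  simp only [Pi.mul_apply, gaussianPDF, dens]
  rw [← ENNReal.ofReal_mul (gaussianPDFReal_nonneg _ _ _)]
  congr 1
  simp only [gaussianPDFReal]
  have e : Real.exp (-(x - 0) ^ 2 / (2 * ((2 : NNReal) : ℝ))) =
      Real.exp (-(x - 0) ^ 2 / (2 * ((1 : NNReal) : ℝ))) * Real.exp (x ^ 2 / 4) := by
    rw [← Real.exp_add]; congr 1; push_cast; ring
  rw [e]
  have e2 : Real.sqrt (2 * Real.pi * ((2 : NNReal) : ℝ)) =
      Real.sqrt (2 * Real.pi * ((1 : NNReal) : ℝ)) * Real.sqrt 2 := by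
    rw [← Real.sqrt_mul (by positivity)]; congr 1; push_cast; ring
  rw [e2, mul_inv]
  ring

lemma pi_two (d : ℕ) : (Measure.pi fun _ : Fin d => gaussianReal 0 2) =
    (stdGauss d).withDensity (fun x => ∏ i, dens (x i)) := by
  refine Measure.pi_eq fun s hs => ?_
  rw [withDensity_apply _ (MeasurableSet.univ_pi hs),
    ← lintegral_indicator (MeasurableSet.univ_pi hs)]
  have hind : ∀ x : Fin d → ℝ, (Set.univ.pi s).indicator (fun x => ∏ i, dens (x i)) x =
      ∏ i, (s i).indicator dens (x i) := by
    intro x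
    by_cases hx : x ∈ Set.univ.pi s
    · rw [Set.indicator_of_mem hx]
      exact Finset.prod_congr rfl fun i _ => (Set.indicator_of_mem (hx i trivial) _).symm
    · rw [Set.indicator_of_notMem hx]
      simp only [Set.mem_pi, Set.mem_univ, true_imp_iff, not_forall] at hx
      obtain ⟨i, hi⟩ := hx
      exact (Finset.prod_eq_zero (Finset.mem_univ i) (Set.indicator_of_notMem hi _)).symm
  simp_rw [hind]
  have hm : ∀ i, Measurable ((s i).indicator dens) := fun i => dens_meas.indicator (hs i)
  have hI := iIndepFun_pi (μ := fun _ : Fin d => gaussianReal 0 1)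
    (X := fun i => (s i).indicator dens) (fun i => (hm i).aemeasurable)
  rw [stdGauss, lintegral_prod_eq_prod_lintegral_of_indepFun _ _ hI
    (fun i => (hm i).comp (measurable_pi_apply i))]
  refine Finset.prod_congr rfl fun i _ => ?_
  rw [gauss_two, withDensity_apply _ (hs i), ← lintegral_indicator (hs i)]
  have := (measurePreserving_eval (fun _ : Fin d => gaussianReal 0 1) i).lintegral_comp (hm i)
  rw [← this]

lemma dens_prod_le (d : ℕ) (hd : 40 ≤ d) (x : Fin d → ℝ) (hx : ∑ i, x i ^ 2 ≤ d) :
    ∏ i, dens (x i) ≤ 2⁻¹ := by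
  unfold dens
  rw [← ENNReal.ofReal_prod_of_nonneg (fun i _ => by positivity), Finset.prod_mul_distrib,
    ← Real.exp_sum, ← Finset.sum_div]
  have h : (2⁻¹ : ENNReal) = ENNReal.ofReal (2⁻¹) := by
    rw [ENNReal.ofReal_inv_of_pos (by norm_num)]; simp
  rw [h]
  apply ENNReal.ofReal_le_ofReal
  simp only [Finset.prod_const, Finset.card_univ, Fintype.card_fin]
  have h1 : Real.exp ((∑ i, x i ^ 2) / 4) ≤ Real.exp (1 / 4) ^ d := by
    rw [← Real.exp_nat_mul]
    apply Real.exp_le_exp.2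
    linarith
  set q : ℝ := (Real.sqrt 2)⁻¹ * Real.exp (1 / 4) with hq
  have hq0 : 0 ≤ q := by positivity
  have hq4 : q ^ 4 = Real.exp 1 / 4 := by
    rw [hq, mul_pow, ← Real.exp_nat_mul, inv_pow]
    have : Real.sqrt 2 ^ 4 = 4 := by
      rw [show Real.sqrt 2 ^ 4 = (Real.sqrt 2 ^ 2) ^ 2 by ring, Real.sq_sqrt (by norm_num)]
      norm_num
    rw [this]
    norm_num
    ring
  have he := Real.exp_one_lt_d9
  have hq4' : q ^ 4 ≤ 7 / 10 := by rw [hq4]; linarith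
  have hq1 : q ≤ 1 := by
    by_contra hc
    push Not at hc
    have := one_lt_pow₀ hc (n := 4) (by norm_num)
    linarith
  calc _ ≤ (Real.sqrt 2)⁻¹ ^ d * Real.exp (1 / 4) ^ d := by gcongr
    _ = q ^ d := by rw [hq, mul_pow]
    _ ≤ q ^ 40 := pow_le_pow_of_le_one hq0 hq1 hd
    _ = (q ^ 4) ^ 10 := by ring
    _ ≤ (7 / 10) ^ 10 := by gcongr
    _ ≤ 2⁻¹ := by norm_num

lemma evNorm_smul {n : ℕ} (c : ℝ) (hc : 0 ≤ c) (v : Fin n → ℝ) :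
    evNorm (fun i => c * v i) = c * evNorm v := by
  unfold evNorm
  simp_rw [mul_pow]
  rw [← Finset.mul_sum, Real.sqrt_mul (by positivity), Real.sqrt_sq hc]

lemma mulVecFn_smul {a b : ℕ} (M : Fin a → Fin b → ℝ) (c : ℝ) (v : Fin b → ℝ) :
    mulVecFn M (fun i => c * v i) = fun j => c * mulVecFn M v j := by
  unfold mulVecFn
  ext j
  rw [Finset.mul_sum]
  exact Finset.sum_congr rfl fun i _ => by ring

lemma evNorm_meas {n : ℕ} : Measurable (evNorm (n := n)) := by
  unfold evNorm; fun_prop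

lemma mulVecFn_meas {a b : ℕ} (M : Fin a → Fin b → ℝ) : Measurable (mulVecFn M) := by
  unfold mulVecFn; fun_prop

/-- For a cone `C`, the Gaussian mass of its part inside the ball is at most half. -/
lemma cone_half (d : ℕ) (hd : 40 ≤ d) (C : Set (Fin d → ℝ)) (hC : MeasurableSet C)
    (hcone : ∀ c : ℝ, 0 < c → ∀ y, (fun i => c * y i) ∈ C ↔ y ∈ C) :
    stdGauss d (C ∩ {y | ∑ i, y i ^ 2 < (d : ℝ) / 2}) ≤ 2⁻¹ * stdGauss d C := by
  have hs : (0 : ℝ) < Real.sqrt 2 := by positivity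
  have hB : MeasurableSet (C ∩ {y | ∑ i, y i ^ 2 < (d : ℝ)}) :=
    hC.inter (measurableSet_lt (by fun_prop) (by fun_prop))
  have e : C ∩ {y | ∑ i, y i ^ 2 < (d : ℝ) / 2} =
      (fun y i => Real.sqrt 2 * y i) ⁻¹' (C ∩ {y | ∑ i, y i ^ 2 < (d : ℝ)}) := by
    ext y
    simp only [Set.mem_inter_iff, Set.mem_preimage, Set.mem_setOf_eq, hcone _ hs]
    refine and_congr_right fun _ => ?_
    simp_rw [mul_pow]
    rw [← Finset.mul_sum, Real.sq_sqrt (by norm_num)]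
    constructor <;> intro h <;> linarith
  rw [e, ← Measure.map_apply (by fun_prop) hB, ← pi_scale d (Real.sqrt 2) 2 (by simp),
    pi_two, withDensity_apply _ hB]
  calc _ ≤ ∫⁻ x in (C ∩ {y | ∑ i, y i ^ 2 < (d : ℝ)}), 2⁻¹ ∂(stdGauss d) :=
        setLIntegral_mono' hB fun x hx => dens_prod_le d hd x hx.2.le
    _ = 2⁻¹ * stdGauss d (C ∩ {y | ∑ i, y i ^ 2 < (d : ℝ)}) := by simp
    _ ≤ _ := by gcongr; exact Set.inter_subset_left

instance (d : ℕ) : IsProbabilityMeasure (stdGauss d) := by unfold stdGauss; infer_instance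

/-- **Statement 15**: comparison between the uniform measure on `r·S^{d−1}` and the Gaussian
`N(0, (2r²/d)·I_d)` for norms of linear images. -/
theorem stmt15 (d : ℕ) (hd : 40 ≤ d) (k : ℕ) (r t : ℝ) (hr : 0 ≤ r) (ht : 0 ≤ t)
    (M : Fin k → Fin d → ℝ) :
    unifSphere d r {z | evNorm (mulVecFn M z) ≥ t} ≤
      2 * (Measure.pi fun _ : Fin d => gaussianReal 0 ((2 * r ^ 2 / d).toNNReal))
            {y | evNorm (mulVecFn M y) ≥ t} := by
  have hd0 : (0 : ℝ) < d := by exact_mod_cast (by omega : 0 < d)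
  have hS : MeasurableSet {z : Fin d → ℝ | evNorm (mulVecFn M z) ≥ t} :=
    measurableSet_le measurable_const (evNorm_meas.comp (mulVecFn_meas M))
  have hpm : Measurable (fun (y : Fin d → ℝ) => fun i => (r / evNorm y) * y i) := by
    have := evNorm_meas (n := d)
    fun_prop
  have hv : (((2 * r ^ 2 / d).toNNReal : NNReal) : ℝ) = (Real.sqrt (2 * r ^ 2 / d)) ^ 2 := by
    rw [Real.sq_sqrt (by positivity), Real.coe_toNNReal _ (by positivity)]
  rw [pi_scale d _ _ hv, unifSphere, Measure.map_apply hpm hS,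
    Measure.map_apply (by fun_prop) hS]
  set s := Real.sqrt (2 * r ^ 2 / d) with hs
  set C := (fun (y : Fin d → ℝ) => fun i => (r / evNorm y) * y i) ⁻¹'
    {z | evNorm (mulVecFn M z) ≥ t} with hCdef
  have hC : MeasurableSet C := hpm hS
  have hcone : ∀ c : ℝ, 0 < c → ∀ y, (fun i => c * y i) ∈ C ↔ y ∈ C := by
    intro c hc y
    have : (fun i => (r / evNorm (fun i => c * y i)) * (c * y i)) =
        fun i => (r / evNorm y) * y i := by
      ext i
      rw [evNorm_smul c hc.le]
      rw [← mul_assoc]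
      congr 1
      rw [div_mul_eq_mul_div, mul_comm r c, mul_div_mul_left _ _ hc.ne']
    simp only [hCdef, Set.mem_preimage, this]
  have key := cone_half d hd C hC hcone
  set B : Set (Fin d → ℝ) := {y | ∑ i, y i ^ 2 < (d : ℝ) / 2}
  have hsub : C \ B ⊆ (fun y i => s * y i) ⁻¹' {z | evNorm (mulVecFn M z) ≥ t} := by
    rintro y ⟨hyC, hyB⟩
    simp only [B, Set.mem_setOf_eq, not_lt] at hyB
    simp only [hCdef, Set.mem_preimage, Set.mem_setOf_eq, mulVecFn_smul, ge_iff_le] at hyC ⊢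
    have hn : 0 < evNorm y := Real.sqrt_pos.2 (by linarith)
    have hr' : 0 ≤ r / evNorm y := by positivity
    have hs0 : 0 ≤ s := Real.sqrt_nonneg _
    rw [evNorm_smul _ hr'] at hyC
    rw [evNorm_smul _ hs0]
    have hle : r / evNorm y ≤ s := by
      rw [div_le_iff₀ hn, hs, evNorm, ← Real.sqrt_mul (by positivity)]
      apply Real.le_sqrt_of_sq_le
      calc r ^ 2 = 2 * r ^ 2 / d * (d / 2) := by field_simp
        _ ≤ _ := by gcongr
    exact hyC.trans (mul_le_mul_of_nonneg_right hle (Real.sqrt_nonneg _))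
  have hB : MeasurableSet B := measurableSet_lt (by fun_prop) (by fun_prop)
  have hsum := measure_inter_add_diff (μ := stdGauss d) C hB
  have h3 : stdGauss d C ≤ 2 * stdGauss d (C \ B) := by
    have hfin : stdGauss d C ≠ ⊤ := measure_ne_top _ _
    have h1 : 2 * stdGauss d (C ∩ B) ≤ stdGauss d C := by
      calc _ ≤ 2 * (2⁻¹ * stdGauss d C) := by gcongr
        _ = _ := by rw [← mul_assoc, ENNReal.mul_inv_cancel (by simp) (by simp), one_mul]
    have h2 : stdGauss d C + stdGauss d C ≤ stdGauss d C + 2 * stdGauss d (C \ B) := by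
      calc _ = 2 * stdGauss d (C ∩ B) + 2 * stdGauss d (C \ B) := by
            rw [← mul_add, hsum, two_mul]
        _ ≤ _ := by gcongr
    exact (ENNReal.add_le_add_iff_left hfin).1 h2
  exact h3.trans (by gcongr)

end
end

section
/- Let A be an m × n random matrix with entries A_{ij} i.i.d. N(0,1). Then for every δ ∈ (0,1), with probability at least 1 − δ: ‖A‖ ≤ 3(√m + √n + √(log(1/δ))), where ‖A‖ is the spectral norm. -/
open MeasureTheory ProbabilityTheory

noncomputable section

/-- Spectral (ℓ²-operator) norm of a matrix. -/
def specNorm {a b : ℕ} (M : Fin a → Fin b → ℝ) : ℝ :=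
  sSup {t | ∃ v : Fin b → ℝ, evNorm v ≤ 1 ∧ t = evNorm (mulVecFn M v)}

/-- The law of an `m × n` random matrix with i.i.d. standard Gaussian entries. -/
def stdGaussMat (m n : ℕ) : Measure (Fin m → Fin n → ℝ) :=
  Measure.pi fun _ => Measure.pi fun _ => gaussianReal 0 1


lemma lintegral_pi_prod {ι : Type} [Fintype ι] {E : Type} [MeasurableSpace E] (μ : Measure E)
    [IsProbabilityMeasure μ] (f : ι → E → ENNReal) (hf : ∀ i, Measurable (f i)) :
    ∫⁻ x, ∏ i, f i (x i) ∂(Measure.pi fun _ : ι => μ) = ∏ i, ∫⁻ y, f i y ∂μ := by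
  have hind : iIndepFun (fun i (x : ι → E) => f i (x i)) (Measure.pi fun _ : ι => μ) :=
    iIndepFun_pi (fun i => (hf i).aemeasurable)
  have h := lintegral_prod_eq_prod_lintegral_of_indepFun (s := Finset.univ) (μ := (Measure.pi fun _ : ι => μ))
    (fun i (x : ι → E) => f i (x i)) hind
    (fun i => (hf i).comp (measurable_pi_apply i))
  rw [h]
  refine Finset.prod_congr rfl fun i _ => ?_
  exact (measurePreserving_eval (fun _ : ι => μ) i).lintegral_comp (hf i)

lemma lintegral_exp_gauss (t : ℝ) :
    ∫⁻ x, ENNReal.ofReal (Real.exp (t * x)) ∂(gaussianReal 0 1) =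
      ENNReal.ofReal (Real.exp (t ^ 2 / 2)) := by
  rw [← ofReal_integral_eq_lintegral_ofReal (integrable_exp_mul_gaussianReal t)
    (Filter.Eventually.of_forall fun _ => (Real.exp_pos _).le)]
  have h := congrFun (mgf_fun_id_gaussianReal (μ := 0) (v := 1)) t
  simp only [mgf] at h
  rw [h]; simp

lemma quad_lower (b d z : ℝ) :
    ENNReal.ofReal (Real.exp (b * z + d * (z ^ 2 + 1) - z ^ 2 / 2)) ≤
      ∫⁻ x, ENNReal.ofReal (Real.exp (b * x + d * x ^ 2)) ∂(gaussianReal 0 1) := by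
  set c := b * z + d * (z ^ 2 + 1) - z ^ 2 / 2 with hc
  -- change of measure
  have h1 : ∫⁻ x, ENNReal.ofReal (Real.exp (b * x + d * x ^ 2)) ∂(gaussianReal 0 1)
      = ∫⁻ x, ENNReal.ofReal (Real.exp (b * x + d * x ^ 2 - z * x + z ^ 2 / 2))
        ∂(gaussianReal z 1) := by
    rw [gaussianReal_of_var_ne_zero _ one_ne_zero, gaussianReal_of_var_ne_zero _ one_ne_zero,
      lintegral_withDensity_eq_lintegral_mul _ (measurable_gaussianPDF _ _) (by fun_prop),
      lintegral_withDensity_eq_lintegral_mul _ (measurable_gaussianPDF _ _) (by fun_prop)]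
    refine lintegral_congr fun x => ?_
    simp only [Pi.mul_apply, gaussianPDF]
    rw [← ENNReal.ofReal_mul (gaussianPDFReal_nonneg _ _ _),
      ← ENNReal.ofReal_mul (gaussianPDFReal_nonneg _ _ _)]
    simp only [gaussianPDFReal]
    simp only [mul_assoc, ← Real.exp_add]
    congr 3
    simp
    ring
  rw [h1]
  have m1 : Integrable (fun x : ℝ => x) (gaussianReal z 1) :=
    (memLp_id_gaussianReal (μ := z) (v := 1) 1).integrable (by simp)
  have m2 : Integrable (fun x : ℝ => x ^ 2) (gaussianReal z 1) :=
    (memLp_id_gaussianReal (μ := z) (v := 1) 2).integrable_sq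
  have e2 : ∫ x, x ^ 2 ∂(gaussianReal z 1) = z ^ 2 + 1 := by
    have hv := variance_eq_sub (memLp_id_gaussianReal (μ := z) (v := 1) 2)
    rw [variance_id_gaussianReal] at hv
    simp at hv
    linarith
  have hint : Integrable (fun x : ℝ => Real.exp c * (1 + (b * x + d * x ^ 2 - z * x + z ^ 2 / 2 - c)))
      (gaussianReal z 1) := by
    refine Integrable.const_mul ?_ _
    exact (integrable_const _).add (((((m1.const_mul b).add (m2.const_mul d)).sub
      (m1.const_mul z)).add (integrable_const _)).sub (integrable_const _))
  have hval : ∫ x, Real.exp c * (1 + (b * x + d * x ^ 2 - z * x + z ^ 2 / 2 - c)) ∂(gaussianReal z 1)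
      = Real.exp c := by
    have : ∀ x : ℝ, Real.exp c * (1 + (b * x + d * x ^ 2 - z * x + z ^ 2 / 2 - c)) =
      Real.exp c * ((b - z) * x + d * x ^ 2 + (1 + z ^ 2 / 2 - c)) := fun x => by ring
    simp_rw [this]
    have i1 : Integrable (fun x : ℝ => (b - z) * x) (gaussianReal z 1) := m1.const_mul _
    have i2 : Integrable (fun x : ℝ => d * x ^ 2) (gaussianReal z 1) := m2.const_mul _
    have i3 : Integrable (fun x : ℝ => (b - z) * x + d * x ^ 2) (gaussianReal z 1) := i1.add i2
    rw [integral_const_mul, integral_add i3 (integrable_const _),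
      integral_add i1 i2, integral_const_mul, integral_const_mul, e2,
      integral_id_gaussianReal]
    simp only [integral_const, probReal_univ, one_smul]
    rw [hc]; ring
  calc ENNReal.ofReal (Real.exp c) = ENNReal.ofReal (∫ x, Real.exp c *
        (1 + (b * x + d * x ^ 2 - z * x + z ^ 2 / 2 - c)) ∂(gaussianReal z 1)) := by rw [hval]
    _ ≤ ∫⁻ x, ENNReal.ofReal (Real.exp c *
        (1 + (b * x + d * x ^ 2 - z * x + z ^ 2 / 2 - c))) ∂(gaussianReal z 1) :=
        by
          rw [integral_eq_lintegral_pos_part_sub_lintegral_neg_part hint]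
          exact ENNReal.ofReal_le_of_le_toReal (sub_le_self _ ENNReal.toReal_nonneg)
    _ ≤ _ := by
        refine lintegral_mono fun x => ENNReal.ofReal_le_ofReal ?_
        have := Real.add_one_le_exp (b * x + d * x ^ 2 - z * x + z ^ 2 / 2 - c)
        calc _ ≤ Real.exp c * Real.exp (b * x + d * x ^ 2 - z * x + z ^ 2 / 2 - c) := by
              gcongr; linarith
          _ = _ := by rw [← Real.exp_add]; congr 1; ring

abbrev gam (k : ℕ) : Measure (Fin k → ℝ) := Measure.pi fun _ => gaussianReal 0 1

lemma ofReal_exp_sum {k : ℕ} (f : Fin k → ℝ) :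
    ENNReal.ofReal (Real.exp (∑ i, f i)) = ∏ i, ENNReal.ofReal (Real.exp (f i)) := by
  rw [Real.exp_sum, ENNReal.ofReal_prod_of_nonneg fun i _ => (Real.exp_pos _).le]

lemma quad_lower_pi {k : ℕ} (a : ℝ) (b : Fin k → ℝ) (d : ℝ) (z : Fin k → ℝ) :
    ENNReal.ofReal (Real.exp (a + ∑ i, b i * z i + d * (∑ i, z i ^ 2 + k) - (∑ i, z i ^ 2) / 2)) ≤
      ∫⁻ x, ENNReal.ofReal (Real.exp (a + ∑ i, b i * x i + d * ∑ i, x i ^ 2)) ∂(gam k) := by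
  have e1 : a + ∑ i, b i * z i + d * (∑ i, z i ^ 2 + k) - (∑ i, z i ^ 2) / 2 =
      a + ∑ i, (b i * z i + d * (z i ^ 2 + 1) - z i ^ 2 / 2) := by
    simp only [Finset.sum_sub_distrib, Finset.sum_add_distrib, ← Finset.mul_sum,
      ← Finset.sum_div]
    simp; ring
  have e2 : ∀ x : Fin k → ℝ, ENNReal.ofReal (Real.exp (a + ∑ i, b i * x i + d * ∑ i, x i ^ 2)) =
      ENNReal.ofReal (Real.exp a) *
        ∏ i, ENNReal.ofReal (Real.exp (b i * x i + d * x i ^ 2)) := by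
    intro x
    rw [← ofReal_exp_sum, ← ENNReal.ofReal_mul (Real.exp_pos _).le, ← Real.exp_add,
      Finset.sum_add_distrib, Finset.mul_sum, add_assoc]
  simp_rw [e2]
  rw [e1, Real.exp_add, ENNReal.ofReal_mul (Real.exp_pos _).le, ofReal_exp_sum,
    lintegral_const_mul _ (by fun_prop),
    lintegral_pi_prod _ (fun i y => ENNReal.ofReal (Real.exp (b i * y + d * y ^ 2)))
      (fun i => by fun_prop)]
  gcongr with i
  exact quad_lower _ _ _

/-- The exponent. -/
def Fexp {m n : ℕ} (c : ℝ) (A : Fin m → Fin n → ℝ) (q : (Fin m → ℝ) × (Fin n → ℝ)) : ℝ :=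
  ∑ i, ∑ j, (c * q.1 i * q.2 j) * A i j - c ^ 2 / 2 * (∑ i, q.1 i ^ 2) * (∑ j, q.2 j ^ 2)

def Zfun {m n : ℕ} (c : ℝ) (A : Fin m → Fin n → ℝ) : ENNReal :=
  ∫⁻ q, ENNReal.ofReal (Real.exp (Fexp c A q)) ∂((gam m).prod (gam n))

lemma meas_joint (m n : ℕ) (c : ℝ) : Measurable
    (fun p : (Fin m → Fin n → ℝ) × ((Fin m → ℝ) × (Fin n → ℝ)) =>
      ENNReal.ofReal (Real.exp (Fexp c p.1 p.2))) := by
  unfold Fexp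
  fun_prop

lemma meas_Z (m n : ℕ) (c : ℝ) : Measurable (Zfun (m := m) (n := n) c) :=
  (meas_joint m n c).lintegral_prod_right'

instance (m n : ℕ) : IsProbabilityMeasure (stdGaussMat m n) := by
  unfold stdGaussMat; infer_instance

lemma lint_F (m n : ℕ) (c : ℝ) (q : (Fin m → ℝ) × (Fin n → ℝ)) :
    ∫⁻ A, ENNReal.ofReal (Real.exp (Fexp c A q)) ∂(stdGaussMat m n) = 1 := by
  set K := c ^ 2 / 2 * (∑ i, q.1 i ^ 2) * (∑ j, q.2 j ^ 2) with hK
  have e : ∀ A : Fin m → Fin n → ℝ, ENNReal.ofReal (Real.exp (Fexp c A q)) =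
      ENNReal.ofReal (Real.exp (-K)) *
      ∏ i, ∏ j, ENNReal.ofReal (Real.exp ((c * q.1 i * q.2 j) * A i j)) := by
    intro A
    simp_rw [← ofReal_exp_sum]
    rw [← ENNReal.ofReal_mul (Real.exp_pos _).le, ← Real.exp_add]
    congr 2
    simp only [Fexp, ← hK]; ring
  simp_rw [e]
  rw [lintegral_const_mul _ (by fun_prop)]
  unfold stdGaussMat
  rw [lintegral_pi_prod (Measure.pi fun _ : Fin n => gaussianReal 0 1)
    (fun i (y : Fin n → ℝ) => ∏ j, ENNReal.ofReal (Real.exp ((c * q.1 i * q.2 j) * y j)))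
      (fun i => by fun_prop)]
  have e3 : ∀ i, ∫⁻ y : Fin n → ℝ, ∏ j, ENNReal.ofReal (Real.exp ((c * q.1 i * q.2 j) * y j))
      ∂(Measure.pi fun _ : Fin n => gaussianReal 0 1) =
      ENNReal.ofReal (Real.exp (∑ j, (c * q.1 i * q.2 j) ^ 2 / 2)) := by
    intro i
    rw [lintegral_pi_prod (gaussianReal 0 1)
      (fun j (y : ℝ) => ENNReal.ofReal (Real.exp ((c * q.1 i * q.2 j) * y)))
      (fun i => by fun_prop), ofReal_exp_sum]
    exact Finset.prod_congr rfl fun j _ => lintegral_exp_gauss _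
  simp_rw [e3]
  rw [← ofReal_exp_sum, ← ENNReal.ofReal_mul (Real.exp_pos _).le, ← Real.exp_add]
  have : -K + ∑ i, ∑ j, (c * q.1 i * q.2 j) ^ 2 / 2 = 0 := by
    rw [hK, mul_assoc, Finset.sum_mul_sum]
    simp only [Finset.mul_sum]
    rw [neg_add_eq_zero]
    refine Finset.sum_congr rfl fun i _ => Finset.sum_congr rfl fun j _ => ?_
    ring
  rw [this]; simp

lemma lint_Z (m n : ℕ) (c : ℝ) : ∫⁻ A, Zfun c A ∂(stdGaussMat m n) = 1 := by
  unfold Zfun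
  rw [lintegral_lintegral_swap (meas_joint m n c).aemeasurable]
  simp_rw [lint_F]
  simp

lemma Z_lower {m n : ℕ} (c : ℝ) (A : Fin m → Fin n → ℝ) (w : Fin m → ℝ) (z : Fin n → ℝ) :
    ENNReal.ofReal (Real.exp (c * ∑ i, w i * mulVecFn A z i
      - c ^ 2 / 2 * (∑ i, w i ^ 2 + m) * (∑ j, z j ^ 2 + n)
      - (∑ i, w i ^ 2) / 2 - (∑ j, z j ^ 2) / 2)) ≤ Zfun c A := by
  unfold Zfun
  rw [lintegral_prod _ (by unfold Fexp; fun_prop)]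
  have inner : ∀ g : Fin m → ℝ,
      ENNReal.ofReal (Real.exp (-(∑ j, z j ^ 2) / 2 + ∑ i, (c * mulVecFn A z i) * g i
        + (-c ^ 2 / 2 * (∑ j, z j ^ 2 + n)) * ∑ i, g i ^ 2)) ≤
      ∫⁻ h, ENNReal.ofReal (Real.exp (Fexp c A (g, h))) ∂(gam n) := by
    intro g
    have h := quad_lower_pi 0 (fun j => ∑ i, c * g i * A i j) (-c ^ 2 / 2 * ∑ i, g i ^ 2) z
    convert h using 3
    · have : ∑ i, (c * mulVecFn A z i) * g i = ∑ j, (∑ i, c * g i * A i j) * z j := by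
        simp only [mulVecFn, Finset.mul_sum, Finset.sum_mul]
        rw [Finset.sum_comm]
        refine Finset.sum_congr rfl fun i _ => Finset.sum_congr rfl fun j _ => ?_
        ring
      rw [this]; ring
    · rename_i h
      congr 1
      have : ∑ i, ∑ j, (c * g i * h j) * A i j = ∑ j, (∑ i, c * g i * A i j) * h j := by
        simp only [Finset.sum_mul]
        rw [Finset.sum_comm]
        refine Finset.sum_congr rfl fun i _ => Finset.sum_congr rfl fun j _ => ?_
        ring
      simp only [Fexp]
      rw [this]; ring
  refine le_trans ?_ (lintegral_mono inner)
  refine le_trans (le_of_eq ?_) (quad_lower_pi _ _ _ w)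
  congr 2
  have : ∑ i, c * mulVecFn A z i * w i = c * ∑ i, w i * mulVecFn A z i := by
    rw [Finset.mul_sum]
    exact Finset.sum_congr rfl fun i _ => by ring
  rw [this]; ring

lemma evNorm_sq {n : ℕ} (v : Fin n → ℝ) : evNorm v ^ 2 = ∑ i, v i ^ 2 :=
  Real.sq_sqrt (Finset.sum_nonneg fun _ _ => sq_nonneg _)

lemma evNorm_nonneg {n : ℕ} (v : Fin n → ℝ) : 0 ≤ evNorm v := Real.sqrt_nonneg _

/-- Deterministic consequence of `Z < 1/δ`. -/
lemma det_bound {m n : ℕ} (p L : ℝ) (hp : 0 < p) (hm : 0 < m) (hn : 0 < n)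
    (A : Fin m → Fin n → ℝ)
    (hZ : Zfun (p / (Real.sqrt m * Real.sqrt n)) A < ENNReal.ofReal (Real.exp L))
    (v : Fin n → ℝ) (hv : evNorm v ≤ 1) :
    p * evNorm (mulVecFn A v) ≤ 2 * p ^ 2 + m / 2 + n / 2 + L ∨ evNorm (mulVecFn A v) = 0 := by
  by_cases h0 : evNorm (mulVecFn A v) = 0
  · exact Or.inr h0
  left
  set s := evNorm (mulVecFn A v) with hs
  have hm' : (0:ℝ) < m := by exact_mod_cast hm
  have hn' : (0:ℝ) < n := by exact_mod_cast hn
  have hsm := Real.sq_sqrt hm'.le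
  have hsn := Real.sq_sqrt hn'.le
  have psm := Real.sqrt_pos.2 hm'
  have psn := Real.sqrt_pos.2 hn'
  set a := Real.sqrt m
  set b := Real.sqrt n
  have hlow := Z_lower (p / (a * b)) A (fun i => a / s * mulVecFn A v i) (fun j => b * v j)
  have hlt := lt_of_le_of_lt hlow hZ
  rw [ENNReal.ofReal_lt_ofReal_iff (Real.exp_pos _), Real.exp_lt_exp] at hlt
  have f1 : mulVecFn A (fun j => b * v j) = fun i => b * mulVecFn A v i := by
    funext i
    simp only [mulVecFn, Finset.mul_sum]
    exact Finset.sum_congr rfl fun j _ => by ring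
  have f2 : ∑ i, (a / s * mulVecFn A v i) ^ 2 = m := by
    simp only [mul_pow]
    rw [← Finset.mul_sum, ← evNorm_sq, ← hs, ← hsm]
    field_simp
  have f3 : ∑ i, (a / s * mulVecFn A v i) * (b * mulVecFn A v i) = a * b * s := by
    have : ∀ i, (a / s * mulVecFn A v i) * (b * mulVecFn A v i) =
      (a * b / s) * (mulVecFn A v i) ^ 2 := fun i => by ring
    simp only [this]
    rw [← Finset.mul_sum, ← evNorm_sq, ← hs]
    field_simp
  have f4 : ∑ j, (b * v j) ^ 2 = n * evNorm v ^ 2 := by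
    simp only [mul_pow]
    rw [← Finset.mul_sum, ← evNorm_sq, hsn]
  have hv2 : evNorm v ^ 2 ≤ 1 := by nlinarith [evNorm_nonneg v]
  simp only [f1, f2, f3, f4] at hlt
  have g1 : p / (a * b) * (a * b * s) = p * s := by field_simp
  have g2 : (p / (a * b)) ^ 2 / 2 * (m + m) * (n * evNorm v ^ 2 + n) =
      p ^ 2 * (evNorm v ^ 2 + 1) := by
    rw [← hsm, ← hsn]; field_simp; ring
  rw [g1, g2] at hlt
  nlinarith [mul_nonneg (sq_nonneg p) (sub_nonneg.2 hv2), mul_nonneg hn'.le (sub_nonneg.2 hv2)]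

lemma specNorm_le {a b : ℕ} (M : Fin a → Fin b → ℝ) (B : ℝ) (hB : 0 ≤ B)
    (h : ∀ v, evNorm v ≤ 1 → evNorm (mulVecFn M v) ≤ B) : specNorm M ≤ B := by
  unfold specNorm
  refine Real.sSup_le ?_ hB
  rintro t ⟨v, hv, rfl⟩
  exact h v hv

/-- **Statement 16**: with probability at least `1 − δ`, the spectral norm of an `m × n`
matrix with i.i.d. `N(0,1)` entries is at most `3(√m + √n + √(log(1/δ)))`. -/
theorem stmt16 (m n : ℕ) (δ : ℝ) (hδ : δ ∈ Set.Ioo (0:ℝ) 1) :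
    stdGaussMat m n
        {A | specNorm A ≤ 3 * (Real.sqrt m + Real.sqrt n + Real.sqrt (Real.log (1/δ)))} ≥
      ENNReal.ofReal (1 - δ) := by
  obtain ⟨h0, h1⟩ := hδ
  have hB : 0 ≤ 3 * (Real.sqrt m + Real.sqrt n + Real.sqrt (Real.log (1/δ))) := by positivity
  by_cases hdeg : m = 0 ∨ n = 0
  · have : {A : Fin m → Fin n → ℝ | specNorm A ≤
        3 * (Real.sqrt m + Real.sqrt n + Real.sqrt (Real.log (1/δ)))} = Set.univ := by
      refine Set.eq_univ_of_forall fun A => specNorm_le A _ hB fun v _ => ?_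
      refine le_trans (le_of_eq ?_) hB
      rcases hdeg with h | h <;> subst h <;> simp [evNorm, mulVecFn]
    rw [this, measure_univ]
    exact ENNReal.ofReal_le_one.2 (by linarith)
  push Not at hdeg
  have hm : 0 < m := Nat.pos_of_ne_zero hdeg.1
  have hn : 0 < n := Nat.pos_of_ne_zero hdeg.2
  have hm' : (0:ℝ) < m := by exact_mod_cast hm
  have hn' : (0:ℝ) < n := by exact_mod_cast hn
  have hL : 0 < Real.log (1/δ) := Real.log_pos (by rw [lt_div_iff₀ h0]; linarith)
  set L := Real.log (1/δ) with hLdef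
  have hexpL : Real.exp L = 1 / δ := Real.exp_log (by positivity)
  set K : ℝ := m + n + 2 * L with hK
  have hKpos : 0 < K := by positivity
  set p : ℝ := Real.sqrt K / 2 with hp
  have hppos : 0 < p := by have := Real.sqrt_pos.2 hKpos; positivity
  have hpK : 4 * p ^ 2 = K := by rw [hp, div_pow, Real.sq_sqrt hKpos.le]; ring
  set c := p / (Real.sqrt m * Real.sqrt n) with hc
  set T : Set (Fin m → Fin n → ℝ) := {A | ENNReal.ofReal (Real.exp L) ≤ Zfun c A} with hT
  have hTm : MeasurableSet T := measurableSet_le measurable_const (meas_Z m n c)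
  have hTle : stdGaussMat m n T ≤ ENNReal.ofReal δ := by
    have := meas_ge_le_lintegral_div (μ := stdGaussMat m n) (meas_Z m n c).aemeasurable
      (ε := ENNReal.ofReal (Real.exp L)) (by simp [Real.exp_pos]) (by simp)
    rw [lint_Z] at this
    refine this.trans (le_of_eq ?_)
    rw [hexpL, one_div, one_div, ENNReal.ofReal_inv_of_pos h0, inv_inv]
  have hsub : Tᶜ ⊆ {A | specNorm A ≤ 3 * (Real.sqrt m + Real.sqrt n + Real.sqrt L)} := by
    intro A hA
    have hZ : Zfun c A < ENNReal.ofReal (Real.exp L) := not_le.1 hA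
    refine specNorm_le A _ hB fun v hv => ?_
    rcases det_bound p L hppos hm hn A hZ v hv with h | h
    · have hs4 : evNorm (mulVecFn A v) ≤ 4 * p := by
        have : p * evNorm (mulVecFn A v) ≤ p * (4 * p) := by nlinarith
        exact le_of_mul_le_mul_left this hppos
      refine hs4.trans ?_
      refine abs_le_of_sq_le_sq' ?_ hB |>.2
      have q1 := Real.sq_sqrt hm'.le
      have q2 := Real.sq_sqrt hn'.le
      have q3 := Real.sq_sqrt hL.le
      have r1 := Real.sqrt_nonneg (m:ℝ)
      have r2 := Real.sqrt_nonneg (n:ℝ)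
      have r3 := Real.sqrt_nonneg L
      nlinarith [mul_nonneg r1 r2, mul_nonneg r1 r3, mul_nonneg r2 r3]
    · rw [h]; exact hB
  calc ENNReal.ofReal (1 - δ) = 1 - ENNReal.ofReal δ := by
        rw [ENNReal.ofReal_sub _ h0.le, ENNReal.ofReal_one]
    _ ≤ 1 - stdGaussMat m n T := tsub_le_tsub_left hTle _
    _ = stdGaussMat m n Tᶜ := (prob_compl_eq_one_sub hTm).symm
    _ ≤ _ := measure_mono hsub

end
end
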